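/- Fix r > 0 and φ ∈ ℝ with Δ(r,φ) > 0. Then for each t ∈ ℝ the function e ↦ ℬ(e; r, φ, t) is C^∞ on a neighborhood of e = 0 in [0,1), ℬ(0; r, φ, t) = 1/Δ(r,φ) is independent of t, and the first-order term of its e-expansion is ∂ℬ/∂e (0; r, φ, t) = (2·cos(t) − 3r·cos(φ+t) + r·cos(φ−t))/(2·Δ(r,φ)³). In particular, as a function of t, the first-order term is a trigonometric polynomial containing only the harmonics e^{it} and e^{−it}. -/

import Mathlib

/-- `C(e,ℓ) = (cos(u(e,ℓ)) − e)/(1 − e·cos(u(e,ℓ)))`, the cosine of the true anomaly. -/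
noncomputable def Cfun (U : ℝ → ℝ → ℝ) (e ℓ : ℝ) : ℝ :=
  (Real.cos (U e ℓ) - e) / (1 - e * Real.cos (U e ℓ))

/-- `S(e,ℓ) = √(1−e²)·sin(u(e,ℓ))/(1 − e·cos(u(e,ℓ)))`, the sine of the true anomaly. -/
noncomputable def Sfun (U : ℝ → ℝ → ℝ) (e ℓ : ℝ) : ℝ :=
  Real.sqrt (1 - e ^ 2) * Real.sin (U e ℓ) / (1 - e * Real.cos (U e ℓ))

/-- `ρ(e,t) = 1 − e·cos(u(e,t))`, the radius of the Kepler ellipse. -/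
noncomputable def rho (U : ℝ → ℝ → ℝ) (e t : ℝ) : ℝ := 1 - e * Real.cos (U e t)

/-- `Δ(r,φ) = (r² + 1 − 2r·cos φ)^{1/2}`. -/
noncomputable def Delta (r φ : ℝ) : ℝ := Real.sqrt (r ^ 2 + 1 - 2 * r * Real.cos φ)

/-- `ℬ(e; r, φ, t)`: the reciprocal of the distance between the point with polar
coordinates `(r,φ)` in the rotating frame and the point `q_e(t)` of the Kepler
ellipse of eccentricity `e`. -/
noncomputable def Bfun (U : ℝ → ℝ → ℝ) (r φ e t : ℝ) : ℝ :=
  1 / Real.sqrt (r ^ 2 + rho U e t ^ 2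
      - 2 * r * rho U e t
        * (Real.cos (φ + t) * Cfun U e t + Real.sin (φ + t) * Sfun U e t))

open scoped Topology ContDiff

lemma kepler_unique {e u v : ℝ} (he : e ∈ Set.Ico (0:ℝ) 1)
    (h : u - e * Real.sin u = v - e * Real.sin v) : u = v := by
  have h1 : |Real.sin u - Real.sin v| ≤ |u - v| := by
    have := Real.lipschitzWith_sin.dist_le_mul u v
    simpa [Real.dist_eq] using this
  have h2 : u - v = e * (Real.sin u - Real.sin v) := by linarith
  have h3 : |u - v| = e * |Real.sin u - Real.sin v| := by
    conv_lhs => rw [h2]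
    rw [abs_mul, abs_of_nonneg he.1]
  have h4 : |u - v| ≤ e * |u - v| := by
    rw [h3]
    have := mul_le_mul_of_nonneg_left h1 he.1
    nlinarith [he.1]
  have h5 : |u - v| = 0 := by
    have := abs_nonneg (u - v)
    nlinarith [he.2]
  exact sub_eq_zero.mp (abs_eq_zero.mp h5)

lemma kepler_local (t : ℝ) : ∃ g : ℝ → ℝ, ContDiffAt ℝ ω g 0 ∧ g 0 = t ∧
    HasDerivAt g (Real.sin t) 0 ∧ ∀ᶠ e in 𝓝 (0:ℝ), g e - e * Real.sin (g e) = t := by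
  let f : ℝ × ℝ → ℝ := fun p => p.2 - p.1 * Real.sin p.2
  have cdf : ContDiffAt ℝ ω f (0, t) := by
    have h2 : ContDiffAt ℝ ω (fun p : ℝ × ℝ => Real.sin p.2) (0, t) :=
      Real.contDiff_sin.contDiffAt.comp (0, t) contDiffAt_snd
    exact contDiffAt_snd.sub (contDiffAt_fst.mul h2)
  have hd : DifferentiableAt ℝ f (0, t) := cdf.differentiableAt (by simp)
  have hid : fderiv ℝ f (0, t) ∘L .inr ℝ ℝ ℝ = ContinuousLinearMap.id ℝ ℝ := by
    have hc : HasFDerivAt (fun y : ℝ => f (0, y))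
        (fderiv ℝ f (0, t) ∘L .inr ℝ ℝ ℝ) t :=
      HasFDerivAt.comp (f := fun y : ℝ => ((0:ℝ), y)) t hd.hasFDerivAt
        (hasFDerivAt_prodMk_right (0:ℝ) t)
    have hc2 : HasFDerivAt (fun y : ℝ => f (0, y)) (ContinuousLinearMap.id ℝ ℝ) t := by
      have : (fun y : ℝ => f (0, y)) = id := by funext y; simp [f]
      rw [this]; exact hasFDerivAt_id t
    exact hc.unique hc2
  have hinv : (fderiv ℝ f (0, t) ∘L .inr ℝ ℝ ℝ).IsInvertible := by
    rw [hid]; exact ⟨ContinuousLinearEquiv.refl ℝ ℝ, rfl⟩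
  have hω : (ω : WithTop ℕ∞) ≠ 0 := by simp
  have g1 := cdf.contDiffAt_implicitFunction hω hinv
  have g2 := cdf.implicitFunction_apply_self hω hinv
  have g3 := cdf.eventually_apply_implicitFunction hω hinv
  generalize cdf.implicitFunction hω hinv = g at g1 g2 g3
  simp only at g1 g2 g3
  have g4 : ∀ᶠ e in 𝓝 (0:ℝ), g e - e * Real.sin (g e) = t := by
    filter_upwards [g3] with e he
    simpa [f] using he
  refine ⟨g, g1, g2, ?_, g4⟩
  have hg : HasDerivAt g (deriv g 0) 0 := (g1.differentiableAt (by simp)).hasDerivAt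
  have h1 := hg.sub ((hasDerivAt_id (0:ℝ)).mul hg.sin)
  have h2 : HasDerivAt (fun e => g e - e * Real.sin (g e)) 0 0 :=
    (hasDerivAt_const (0:ℝ) t).congr_of_eventuallyEq g4
  have h3 := h1.unique h2
  simp [g2] at h3
  have : deriv g 0 = Real.sin t := by linarith
  rwa [this] at hg

lemma Bfun_model (g : ℝ → ℝ) (t r φ : ℝ) (hΔ : 0 < Delta r φ)
    (g1 : ContDiffAt ℝ ω g 0) (g2 : g 0 = t) (g3 : HasDerivAt g (Real.sin t) 0) :
    ContDiffAt ℝ ω (fun e => Bfun (fun e _ => g e) r φ e t) 0 ∧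
    Bfun (fun e _ => g e) r φ 0 t = 1 / Delta r φ ∧
    HasDerivAt (fun e => Bfun (fun e _ => g e) r φ e t)
        ((2 * Real.cos t - 3 * r * Real.cos (φ + t) + r * Real.cos (φ - t))
          / (2 * Delta r φ ^ 3)) 0 := by
  have hcosφ : Real.cos (φ + t) * Real.cos t + Real.sin (φ + t) * Real.sin t = Real.cos φ := by
    rw [← Real.cos_sub]; ring_nf
  have hsinφ : Real.sin (φ + t) * Real.cos t - Real.cos (φ + t) * Real.sin t = Real.sin φ := by
    rw [← Real.sin_sub]; ring_nf
  have hpos : 0 < r ^ 2 + 1 - 2 * r * Real.cos φ := Real.sqrt_pos.mp hΔ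
  let N : ℝ → ℝ := fun e => r ^ 2 + rho (fun e _ => g e) e t ^ 2
      - 2 * r * rho (fun e _ => g e) e t
        * (Real.cos (φ + t) * Cfun (fun e _ => g e) e t
          + Real.sin (φ + t) * Sfun (fun e _ => g e) e t)
  have hN0 : N 0 = r ^ 2 + 1 - 2 * r * Real.cos φ := by
    simp only [N, rho, Cfun, Sfun, g2]
    simp [hcosφ]
  have hB : (fun e => Bfun (fun e _ => g e) r φ e t) = fun e => 1 / Real.sqrt (N e) := rfl
  have hNne : N 0 ≠ 0 := by rw [hN0]; exact hpos.ne'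
  have hsne : Real.sqrt (N 0) ≠ 0 := by rw [hN0]; exact hΔ.ne'
  have hcos : ContDiffAt ℝ ω (fun e => Real.cos (g e)) 0 := g1.cos
  have hsin : ContDiffAt ℝ ω (fun e => Real.sin (g e)) 0 := g1.sin
  have hid : ContDiffAt ℝ ω (fun e : ℝ => e) 0 := contDiffAt_id
  have hrho : ContDiffAt ℝ ω (fun e => rho (fun e _ => g e) e t) 0 :=
    contDiffAt_const.sub (hid.mul hcos)
  have hC : ContDiffAt ℝ ω (fun e => Cfun (fun e _ => g e) e t) 0 :=
    (hcos.sub hid).div hrho (by simp [rho])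
  have hS : ContDiffAt ℝ ω (fun e => Sfun (fun e _ => g e) e t) 0 :=
    (((contDiffAt_const.sub (hid.pow 2)).sqrt (by simp)).mul hsin).div hrho (by simp [rho])
  have hN : ContDiffAt ℝ ω N 0 :=
    (contDiffAt_const.add (hrho.pow 2)).sub
      ((contDiffAt_const.mul hrho).mul
        ((contDiffAt_const.mul hC).add (contDiffAt_const.mul hS)))
  -- derivatives
  have dcos : HasDerivAt (fun e => Real.cos (g e)) (-Real.sin t * Real.sin t) 0 := by
    simpa [g2] using g3.cos
  have dsin : HasDerivAt (fun e => Real.sin (g e)) (Real.cos t * Real.sin t) 0 := by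
    simpa [g2] using g3.sin
  have did : HasDerivAt (fun e : ℝ => e) 1 0 := hasDerivAt_id 0
  have drho : HasDerivAt (fun e => rho (fun e _ => g e) e t) (-Real.cos t) 0 := by
    have := (hasDerivAt_const (0:ℝ) (1:ℝ)).sub (did.mul dcos)
    refine this.congr_deriv ?_
    simp [g2]
  have dsq : HasDerivAt (fun e : ℝ => Real.sqrt (1 - e ^ 2)) 0 0 := by
    have := ((hasDerivAt_const (0:ℝ) (1:ℝ)).sub (did.pow 2)).sqrt (by simp)
    refine this.congr_deriv ?_
    simp
  have dC : HasDerivAt (fun e => Cfun (fun e _ => g e) e t) (-2 * Real.sin t ^ 2) 0 := by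
    have := (dcos.sub did).div drho (by simp [rho])
    refine this.congr_deriv ?_
    simp [g2, rho]
    nlinarith [Real.sin_sq_add_cos_sq t]
  have dS : HasDerivAt (fun e => Sfun (fun e _ => g e) e t)
      (2 * Real.sin t * Real.cos t) 0 := by
    have := (dsq.mul dsin).div drho (by simp [rho])
    refine this.congr_deriv ?_
    simp [g2, rho]
    ring
  have dN : HasDerivAt N (-2 * Real.cos t + 2 * r * Real.cos t * Real.cos φ
      - 4 * r * Real.sin t * Real.sin φ) 0 := by
    have := ((hasDerivAt_const (0:ℝ) (r ^ 2)).add (drho.pow 2)).sub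
      ((drho.const_mul (2 * r)).mul
        ((dC.const_mul (Real.cos (φ + t))).add (dS.const_mul (Real.sin (φ + t)))))
    refine this.congr_deriv ?_
    simp [g2, rho, Cfun, Sfun]
    rw [← hcosφ, ← hsinφ]
    ring
  refine ⟨?_, ?_, ?_⟩
  · rw [hB]
    exact contDiffAt_const.div (hN.sqrt hNne) hsne
  · have := congrFun hB 0
    rw [this, hN0]; rfl
  · rw [hB]
    have := (hasDerivAt_const (0:ℝ) (1:ℝ)).div (dN.sqrt hNne) hsne
    refine this.congr_deriv ?_
    have hD : Real.sqrt (N 0) = Delta r φ := by rw [hN0]; rfl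
    rw [hD, Real.cos_add, Real.cos_sub]
    field_simp
    ring

/-- Fix `r > 0` and `φ` with `Δ(r,φ) > 0`. For each `t`, the map
`e ↦ ℬ(e; r, φ, t)` is `C^∞` on a neighborhood of `0` in `[0,1)`,
`ℬ(0) = 1/Δ(r,φ)` (independent of `t`), and
`∂ℬ/∂e(0) = (2·cos t − 3r·cos(φ+t) + r·cos(φ−t))/(2Δ³)`; moreover, as a
function of `t`, this first-order term carries only the harmonics `e^{it}`,
`e^{−it}`. -/
theorem stmt_11 (U : ℝ → ℝ → ℝ)
    (hU : ∀ e ∈ Set.Ico (0:ℝ) 1, ∀ ℓ : ℝ, U e ℓ - e * Real.sin (U e ℓ) = ℓ)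
    (r φ : ℝ) (hr : 0 < r) (hΔ : 0 < Delta r φ) :
    ∀ t : ℝ,
      (∃ ε > 0, ContDiffOn ℝ (⊤ : ℕ∞) (fun e : ℝ => Bfun U r φ e t) (Set.Ico 0 ε)) ∧
      Bfun U r φ 0 t = 1 / Delta r φ ∧
      HasDerivWithinAt (fun e : ℝ => Bfun U r φ e t)
        ((2 * Real.cos t - 3 * r * Real.cos (φ + t) + r * Real.cos (φ - t))
          / (2 * Delta r φ ^ 3))
        (Set.Ici 0) 0 ∧
      (∃ c : ℂ, ∀ s : ℝ,
        (((2 * Real.cos s - 3 * r * Real.cos (φ + s) + r * Real.cos (φ - s))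
            / (2 * Delta r φ ^ 3) : ℝ) : ℂ)
          = c * Complex.exp (Complex.I * s)
            + (starRingEnd ℂ) c * Complex.exp (-(Complex.I * s))) := by
  intro t
  obtain ⟨g, g1, g2, g3, g4⟩ := kepler_local t
  obtain ⟨m1, m2, m3⟩ := Bfun_model g t r φ hΔ g1 g2 g3
  have m1' := m1.eventually (by simp)
  obtain ⟨ε, hε, hball⟩ := Metric.eventually_nhds_iff.mp (g4.and m1')
  have key : ∀ e ∈ Set.Ico (0:ℝ) (min ε 1),
      Bfun U r φ e t = Bfun (fun e _ => g e) r φ e t := by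
    intro e he
    have he1 : e ∈ Set.Ico (0:ℝ) 1 := ⟨he.1, he.2.trans_le (min_le_right _ _)⟩
    have hd : dist e 0 < ε := by
      rw [Real.dist_eq, sub_zero, abs_of_nonneg he.1]
      exact he.2.trans_le (min_le_left _ _)
    have hu : U e t = g e :=
      kepler_unique he1 ((hU e he1 t).trans (hball hd).1.symm)
    simp only [Bfun, rho, Cfun, Sfun, hu]
  have hmin : 0 < min ε 1 := lt_min hε one_pos
  have key0 := key 0 ⟨le_rfl, hmin⟩
  refine ⟨⟨min ε 1, hmin, ?_⟩, key0.trans m2, ?_, ?_⟩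
  · refine ContDiffOn.congr ?_ key
    intro e he
    have hd : dist e 0 < ε := by
      rw [Real.dist_eq, sub_zero, abs_of_nonneg he.1]
      exact he.2.trans_le (min_le_left _ _)
    exact ((hball hd).2.of_le (by exact le_top)).contDiffWithinAt
  · refine m3.hasDerivWithinAt.congr_of_eventuallyEq ?_ key0
    filter_upwards [Ico_mem_nhdsGE hmin] with e he
    exact key e he
  · refine ⟨⟨(1 - r * Real.cos φ) / (2 * Delta r φ ^ 3),
      (-2 * r * Real.sin φ) / (2 * Delta r φ ^ 3)⟩, fun s => ?_⟩
    have e1 : Complex.exp (Complex.I * s) = ⟨Real.cos s, Real.sin s⟩ := by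
      rw [mul_comm]
      apply Complex.ext
      · simp [Complex.exp_ofReal_mul_I_re]
      · simp [Complex.exp_ofReal_mul_I_im]
    have e2 : Complex.exp (-(Complex.I * s)) = ⟨Real.cos s, -Real.sin s⟩ := by
      have : -(Complex.I * (s:ℂ)) = ((-s : ℝ) : ℂ) * Complex.I := by push_cast; ring
      rw [this]
      apply Complex.ext
      · rw [Complex.exp_ofReal_mul_I_re]; simp
      · rw [Complex.exp_ofReal_mul_I_im]; simp
    rw [e1, e2, Real.cos_add, Real.cos_sub]
    apply Complex.ext
    · simp only [Complex.ofReal_re, Complex.add_re, Complex.mul_re, Complex.conj_re,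
        Complex.conj_im]
      ring
    · simp only [Complex.ofReal_im, Complex.add_im, Complex.mul_im, Complex.conj_re,
        Complex.conj_im]
      ring
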